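/- Let v be a Delaunay solution with parameter H₀ ∈ (0, H_max), and let a and p be the associated coefficients. Define Φ⁺(t) := h_v(t)^{(k−1)/2}·(α·v(t) + v′(t))·e^t and Φ⁻(t) := h_v(t)^{(k−1)/2}·(α·v(t) − v′(t))·e^{−t}. Then Φ⁺ and Φ⁻ both satisfy the second-order ODE z″(t) = ((n−1)·a(t) + p(t))·z(t) on ℝ, they are linearly independent, and every C² solution z : ℝ → ℝ of this ODE is of the form z = A·Φ⁺ + B·Φ⁻ for some real constants A and B. -/

import Mathlib

noncomputable section

open Real Set

/-- α = (n−2k)/(2k) -/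
def alp (n k : ℕ) : ℝ := ((n : ℝ) - 2 * (k : ℝ)) / (2 * (k : ℝ))

/-- q = 2kn/(n−2k) -/
def qe (n k : ℕ) : ℝ := (2 * (k : ℝ) * (n : ℝ)) / ((n : ℝ) - 2 * (k : ℝ))

/-- h_v(t) = v(t)² − α⁻² v′(t)² -/
def hDel (n k : ℕ) (v : ℝ → ℝ) (t : ℝ) : ℝ :=
  (v t) ^ 2 - ((alp n k)⁻¹) ^ 2 * (deriv v t) ^ 2

/-- H_v(t) = h_v(t)^k − v(t)^q -/
def HDel (n k : ℕ) (v : ℝ → ℝ) (t : ℝ) : ℝ :=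
  (hDel n k v t) ^ k - (v t) ^ (qe n k)

/-- The Delaunay ODE. -/
def DelODE (n k : ℕ) (v : ℝ → ℝ) : Prop :=
  ∀ t : ℝ, (hDel n k v t) ^ (k - 1) * (v t - ((alp n k)⁻¹) ^ 2 * deriv (deriv v) t)
    = ((n : ℝ) / ((n : ℝ) - 2 * (k : ℝ))) * (v t) ^ (qe n k - 1)

/-- H_max = (2k/(n−2k))·((n−2k)/n)^{n/(2k)} -/
def Hmax (n k : ℕ) : ℝ :=
  (2 * (k : ℝ) / ((n : ℝ) - 2 * (k : ℝ))) *
    (((n : ℝ) - 2 * (k : ℝ)) / (n : ℝ)) ^ ((n : ℝ) / (2 * (k : ℝ)))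

/-- A Delaunay solution with parameter H₀. -/
def DelSol (n k : ℕ) (H₀ : ℝ) (v : ℝ → ℝ) : Prop :=
  ContDiff ℝ (⊤ : ℕ∞) v ∧ (∀ t, 0 < v t) ∧ DelODE n k v ∧
    deriv v 0 = 0 ∧ 0 < deriv (deriv v) 0 ∧ ∀ t, HDel n k v t = H₀

/-- F(t) = v(t)^q/(H₀ + v(t)^q) -/
def FDel (n k : ℕ) (H₀ : ℝ) (v : ℝ → ℝ) (t : ℝ) : ℝ :=
  (v t) ^ (qe n k) / (H₀ + (v t) ^ (qe n k))

/-- The coefficient a(t) of the conjugate linearized operator. -/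
def aDel (n k : ℕ) (H₀ : ℝ) (v : ℝ → ℝ) (t : ℝ) : ℝ :=
  ((n : ℝ) - (k : ℝ)) / ((k : ℝ) * ((n : ℝ) - 1)) +
    ((n : ℝ) * ((k : ℝ) - 1) / ((k : ℝ) * ((n : ℝ) - 1))) * FDel n k H₀ v t

/-- The potential p(t) of the conjugate linearized operator. -/
def pDel (n k : ℕ) (H₀ : ℝ) (v : ℝ → ℝ) (t : ℝ) : ℝ :=
  (alp n k) ^ 2
  + ((n : ℝ) * ((n : ℝ) * (k : ℝ) + (n : ℝ) - 2 * (k : ℝ)) * ((k : ℝ) - 1) /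
      (2 * (k : ℝ) ^ 2)) * FDel n k H₀ v t
  - ((n : ℝ) ^ 2 * ((k : ℝ) ^ 2 - 1) / (4 * (k : ℝ) ^ 2)) * (FDel n k H₀ v t) ^ 2
  - ((n : ℝ) * (2 * (k : ℝ) * (n : ℝ) - (n : ℝ) + 2 * (k : ℝ)) / (4 * (k : ℝ))) *
      (v t) ^ (4 * (k : ℝ) / ((n : ℝ) - 2 * (k : ℝ))) *
      (FDel n k H₀ v t) ^ (((k : ℝ) - 1) / (k : ℝ))
  + ((n : ℝ) ^ 2 * (k : ℝ) * ((k : ℝ) - 1) / (4 * (k : ℝ) ^ 2)) *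
      (v t) ^ (4 * (k : ℝ) / ((n : ℝ) - 2 * (k : ℝ))) *
      (FDel n k H₀ v t) ^ ((2 * (k : ℝ) - 1) / (k : ℝ))
lemma alp_pos {n k : ℕ} (hk : 1 ≤ k) (hkn : 2 * k < n) : 0 < alp n k := by
  have h1 : (1 : ℝ) ≤ k := by exact_mod_cast hk
  have h2 : 2 * (k : ℝ) < n := by exact_mod_cast hkn
  unfold alp
  exact div_pos (by linarith) (by linarith)

namespace DelSol

variable {n k : ℕ} {H₀ : ℝ} {v : ℝ → ℝ}

lemma hasDerivAt (hsol : DelSol n k H₀ v) (t : ℝ) : HasDerivAt v (deriv v t) t :=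
  (hsol.1.differentiable (by simp) t).hasDerivAt

lemma hasDerivAt_deriv (hsol : DelSol n k H₀ v) (t : ℝ) :
    HasDerivAt (deriv v) (deriv (deriv v) t) t := by
  have h : ContDiff ℝ 1 (deriv v) :=
    ((contDiff_succ_iff_deriv (n := 1)).1 (contDiff_infty.1 hsol.1 2)).2.2
  exact (h.differentiable (by simp) t).hasDerivAt

lemma pos (hsol : DelSol n k H₀ v) (t : ℝ) : 0 < v t := hsol.2.1 t

lemma hDel_pow (hsol : DelSol n k H₀ v) (t : ℝ) : hDel n k v t ^ k = H₀ + v t ^ qe n k := by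
  have h := hsol.2.2.2.2.2 t
  unfold HDel at h
  linarith

lemma hDel_pos (hsol : DelSol n k H₀ v) (hk : 1 ≤ k) (hH₀ : 0 < H₀) (t : ℝ) :
    0 < hDel n k v t := by
  have hne : ∀ s, hDel n k v s ≠ 0 := fun s hs => by
    have h := hsol.hDel_pow s
    rw [hs, zero_pow (by omega)] at h
    linarith [rpow_pos_of_pos (hsol.pos s) (qe n k)]
  have hcont : Continuous (hDel n k v) := by
    have h1 : Continuous v := hsol.1.continuous
    have h2 : Continuous (deriv v) :=
      continuous_iff_continuousAt.2 fun s => (hsol.hasDerivAt_deriv s).continuousAt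
    unfold hDel
    fun_prop
  have h0 : 0 < hDel n k v 0 := by
    simpa [hDel, hsol.2.2.2.1] using pow_pos (hsol.pos 0) 2
  by_contra! hneg
  obtain ⟨s, hs⟩ := mem_range_of_exists_le_of_exists_ge hcont ⟨t, hneg⟩ ⟨0, h0.le⟩
  exact hne s hs

lemma FDel_eq (hsol : DelSol n k H₀ v) (t : ℝ) :
    FDel n k H₀ v t = v t ^ qe n k / hDel n k v t ^ k := by
  rw [FDel, hsol.hDel_pow]

lemma deriv_deriv_eq (hsol : DelSol n k H₀ v) (hk : 1 ≤ k) (hkn : 2 * k < n) (hH₀ : 0 < H₀)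
    (t : ℝ) : deriv (deriv v) t * v t = alp n k ^ 2 *
      (v t ^ 2 - (n : ℝ) / (n - 2 * k) * FDel n k H₀ v t * hDel n k v t) := by
  have hα := alp_pos hk hkn
  have hh := hsol.hDel_pos hk hH₀ t
  have hx := hsol.pos t
  have hode := hsol.2.2.1 t
  rw [rpow_sub_one hx.ne'] at hode
  have hpow : hDel n k v t ^ k = hDel n k v t ^ (k - 1) * hDel n k v t := by
    rw [← pow_succ, Nat.sub_add_cancel hk]
  have hp : 0 < hDel n k v t ^ (k - 1) := pow_pos hh _
  rw [hsol.FDel_eq, hpow]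
  generalize (n : ℝ) / (n - 2 * k) = c at *
  generalize hDel n k v t ^ (k - 1) = P at *
  have hode' : v t - (alp n k)⁻¹ ^ 2 * deriv (deriv v) t = c * (v t ^ qe n k / v t) / P := by
    rw [eq_div_iff hp.ne', mul_comm]
    exact hode
  have : deriv (deriv v) t = alp n k ^ 2 * (v t - c * (v t ^ qe n k / v t) / P) := by
    rw [← hode']
    field_simp
    ring
  rw [this]
  field_simp

lemma hasDerivAt_hDel (hsol : DelSol n k H₀ v) (hk : 1 ≤ k) (hkn : 2 * k < n) (hH₀ : 0 < H₀)
    (t : ℝ) : HasDerivAt (hDel n k v)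
      (2 * ((n : ℝ) / (n - 2 * k)) * FDel n k H₀ v t * (deriv v t / v t) * hDel n k v t) t := by
  have hα := alp_pos hk hkn
  have hx := hsol.pos t
  have h := ((hsol.hasDerivAt t).pow 2).sub
    (((hsol.hasDerivAt_deriv t).pow 2).const_mul ((alp n k)⁻¹ ^ 2))
  refine h.congr_deriv ?_
  have h2 := hsol.deriv_deriv_eq hk hkn hH₀ t
  rw [← eq_div_iff hx.ne'] at h2
  rw [h2]
  field_simp
  push_cast
  ring

lemma hasDerivAt_FDel (hsol : DelSol n k H₀ v) (hH₀ : 0 < H₀) (t : ℝ) :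
    HasDerivAt (FDel n k H₀ v)
      (qe n k * FDel n k H₀ v t * (1 - FDel n k H₀ v t) * (deriv v t / v t)) t := by
  have hx := hsol.pos t
  have hq := rpow_pos_of_pos hx (qe n k)
  have h1 := (hsol.hasDerivAt t).rpow_const (p := qe n k) (Or.inl hx.ne')
  have h := h1.div (h1.const_add H₀) (by positivity)
  refine h.congr_deriv ?_
  rw [rpow_sub_one hx.ne', FDel]
  field_simp

lemma hasDerivAt_logDeriv (hsol : DelSol n k H₀ v) (hk : 1 ≤ k) (hkn : 2 * k < n) (hH₀ : 0 < H₀)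
    (t : ℝ) : HasDerivAt (fun s => deriv v s / v s)
      ((alp n k ^ 2 - (deriv v t / v t) ^ 2) * (1 - (n : ℝ) / (n - 2 * k) * FDel n k H₀ v t))
      t := by
  have hα := alp_pos hk hkn
  have hx := hsol.pos t
  have h := (hsol.hasDerivAt_deriv t).div (hsol.hasDerivAt t) hx.ne'
  refine h.congr_deriv ?_
  rw [hsol.deriv_deriv_eq hk hkn hH₀ t, hDel]
  field_simp
  ring

lemma rpow_mul_FDel_rpow (hsol : DelSol n k H₀ v) (hk : 1 ≤ k) (hkn : 2 * k < n) (hH₀ : 0 < H₀)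
    (t : ℝ) : v t ^ (4 * (k : ℝ) / (n - 2 * k)) * FDel n k H₀ v t ^ (((k : ℝ) - 1) / k) =
      FDel n k H₀ v t * (hDel n k v t / v t ^ 2) := by
  have hk0 : (k : ℝ) ≠ 0 := by positivity
  have hnk : (n : ℝ) - 2 * k ≠ 0 := by
    have h2 : 2 * (k : ℝ) < n := by exact_mod_cast hkn
    linarith
  have hh := hsol.hDel_pos hk hH₀ t
  have hx := hsol.pos t
  rw [hsol.FDel_eq, ← rpow_natCast (hDel n k v t) k, div_rpow (by positivity) (by positivity),
    ← rpow_mul hx.le, ← rpow_mul hh.le, ← rpow_natCast (v t) 2, mul_div_assoc',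
    ← rpow_add hx, mul_div_cancel₀ _ hk0, rpow_sub_one hh.ne']
  have he : 4 * (k : ℝ) / (n - 2 * k) + qe n k * ((k - 1) / k) = qe n k - (2 : ℕ) := by
    obtain ⟨d, hd⟩ : ∃ d : ℝ, d = n - 2 * k := ⟨_, rfl⟩
    have hnd : (n : ℝ) = d + 2 * k := by linarith
    rw [← hd] at hnk
    rw [qe, ← hd, hnd]
    push_cast
    field_simp
    ring
  rw [he, rpow_sub hx]
  field_simp

lemma pDel_eq (hsol : DelSol n k H₀ v) (hk : 1 ≤ k) (hkn : 2 * k < n) (hH₀ : 0 < H₀)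
    (t : ℝ) : pDel n k H₀ v t = alp n k ^ 2
      + ((n : ℝ) * (n * k + n - 2 * k) * (k - 1) / (2 * k ^ 2)) * FDel n k H₀ v t
      - ((n : ℝ) ^ 2 * (k ^ 2 - 1) / (4 * k ^ 2)) * FDel n k H₀ v t ^ 2
      - ((n : ℝ) * (2 * k * n - n + 2 * k) / (4 * k)) *
        (FDel n k H₀ v t * (1 - (deriv v t / v t) ^ 2 / alp n k ^ 2))
      + ((n : ℝ) ^ 2 * k * (k - 1) / (4 * k ^ 2)) *
        (FDel n k H₀ v t ^ 2 * (1 - (deriv v t / v t) ^ 2 / alp n k ^ 2)) := by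
  have hα := alp_pos hk hkn
  have hx := hsol.pos t
  have hk0 : (k : ℝ) ≠ 0 := by positivity
  have hF : 0 < FDel n k H₀ v t := by
    have := rpow_pos_of_pos hx (qe n k)
    unfold FDel
    positivity
  have hs : hDel n k v t / v t ^ 2 = 1 - (deriv v t / v t) ^ 2 / alp n k ^ 2 := by
    rw [hDel]
    field_simp
  have h := hsol.rpow_mul_FDel_rpow hk hkn hH₀ t
  rw [hs] at h
  have he : (2 * (k : ℝ) - 1) / k = (k - 1) / k + 1 := by field_simp; ring
  rw [pDel, he, rpow_add_one hF.ne', mul_assoc _ (v t ^ _), h,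
    mul_assoc _ (v t ^ _), ← mul_assoc (v t ^ _), h]
  ring

lemma hasDerivAt_weight (hsol : DelSol n k H₀ v) (hk : 1 ≤ k) (hkn : 2 * k < n) (hH₀ : 0 < H₀)
    (ε t : ℝ) : HasDerivAt
      (fun s => hDel n k v s ^ (((k : ℝ) - 1) / 2) * v s * exp (ε * s))
      ((((k : ℝ) - 1) * (n / (n - 2 * k)) * FDel n k H₀ v t * (deriv v t / v t)
          + deriv v t / v t + ε) *
        (hDel n k v t ^ (((k : ℝ) - 1) / 2) * v t * exp (ε * t))) t := by
  have hh := hsol.hDel_pos hk hH₀ t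
  have hx := hsol.pos t
  have h1 := (hsol.hasDerivAt_hDel hk hkn hH₀ t).rpow_const (p := ((k : ℝ) - 1) / 2)
    (Or.inl hh.ne')
  have h2 := ((hasDerivAt_id t).const_mul ε).exp
  have h := (h1.mul (hsol.hasDerivAt t)).mul h2
  refine h.congr_deriv ?_
  rw [rpow_sub_one hh.ne']
  simp only [id, Pi.mul_apply]
  field_simp

end DelSol

/-- The conjugate Jacobi field with sign `ε`. -/
def jacobiConj (n k : ℕ) (v : ℝ → ℝ) (ε t : ℝ) : ℝ :=
  hDel n k v t ^ (((k : ℝ) - 1) / 2) * (alp n k * v t + ε * deriv v t) * exp (ε * t)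

/-- The derivative of `jacobiConj` along a Delaunay solution. -/
def jacobiConjDeriv (n k : ℕ) (H₀ : ℝ) (v : ℝ → ℝ) (ε t : ℝ) : ℝ :=
  (hDel n k v t ^ (((k : ℝ) - 1) / 2) * v t * exp (ε * t)) *
    ((((k : ℝ) - 1) * (n / (n - 2 * k)) * FDel n k H₀ v t * (deriv v t / v t)
        + deriv v t / v t + ε) * (alp n k + ε * (deriv v t / v t)) +
      ε * ((alp n k ^ 2 - (deriv v t / v t) ^ 2) *
        (1 - (n : ℝ) / (n - 2 * k) * FDel n k H₀ v t)))

namespace DelSol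

variable {n k : ℕ} {H₀ : ℝ} {v : ℝ → ℝ}

lemma jacobiConj_eq (hsol : DelSol n k H₀ v) (ε : ℝ) : jacobiConj n k v ε =
    fun t => (hDel n k v t ^ (((k : ℝ) - 1) / 2) * v t * exp (ε * t)) *
      (alp n k + ε * (deriv v t / v t)) := by
  ext t
  have hx := hsol.pos t
  unfold jacobiConj
  field_simp

lemma hasDerivAt_jacobiConj (hsol : DelSol n k H₀ v) (hk : 1 ≤ k) (hkn : 2 * k < n)
    (hH₀ : 0 < H₀) (ε t : ℝ) :
    HasDerivAt (jacobiConj n k v ε) (jacobiConjDeriv n k H₀ v ε t) t := by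
  rw [hsol.jacobiConj_eq]
  have h := (hsol.hasDerivAt_weight hk hkn hH₀ ε t).mul
    (((hsol.hasDerivAt_logDeriv hk hkn hH₀ t).const_mul ε).const_add (alp n k))
  refine h.congr_deriv ?_
  rw [jacobiConjDeriv]
  ring

lemma hasDerivAt_jacobiConjDeriv (hsol : DelSol n k H₀ v) (hk : 1 ≤ k) (hkn : 2 * k < n)
    (hH₀ : 0 < H₀) {ε : ℝ} (hε : ε = 1 ∨ ε = -1) (t : ℝ) :
    HasDerivAt (jacobiConjDeriv n k H₀ v ε)
      ((((n : ℝ) - 1) * aDel n k H₀ v t + pDel n k H₀ v t) * jacobiConj n k v ε t) t := by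
  have hw := hsol.hasDerivAt_logDeriv hk hkn hH₀ t
  have hF := hsol.hasDerivAt_FDel hH₀ t
  have hE := hsol.hasDerivAt_weight hk hkn hH₀ ε t
  have h := hE.mul
    ((((((hF.const_mul (((k : ℝ) - 1) * (n / (n - 2 * k)))).mul hw).add hw).add_const ε).mul
        ((hw.const_mul ε).const_add (alp n k))).add
      ((((hw.pow 2).const_sub (alp n k ^ 2)).mul
        ((hF.const_mul ((n : ℝ) / (n - 2 * k))).const_sub 1)).const_mul ε))
  refine h.congr_deriv ?_
  rw [hsol.pDel_eq hk hkn hH₀, aDel, hsol.jacobiConj_eq]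
  simp only [Pi.mul_apply, Pi.add_apply, Pi.pow_apply]
  generalize hDel n k v t ^ (((k : ℝ) - 1) / 2) * v t * exp (ε * t) = E
  generalize deriv v t / v t = w
  generalize FDel n k H₀ v t = F
  have h1 : (1 : ℝ) ≤ k := by exact_mod_cast hk
  have h2 : 2 * (k : ℝ) < n := by exact_mod_cast hkn
  have hn : (n : ℝ) - 1 ≠ 0 := by linarith
  obtain ⟨d, hd⟩ : ∃ d : ℝ, d = n - 2 * k := ⟨_, rfl⟩
  have hd0 : d ≠ 0 := by linarith
  have hk0 : (k : ℝ) ≠ 0 := by linarith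
  have hnd : (n : ℝ) = d + 2 * k := by linarith
  rw [alp, qe, ← hd]
  have ha : ((n : ℝ) - 1) * (((n : ℝ) - k) / (k * (n - 1)) + (n * ((k : ℝ) - 1) / (k * (n - 1))) * F)
      = ((n : ℝ) - k) / k + (n * ((k : ℝ) - 1) / k) * F := by
    field_simp
  rw [ha, hnd]
  generalize (k : ℝ) = κ at *
  rcases hε with rfl | rfl
  · field_simp
    push_cast
    ring
  · field_simp
    push_cast
    ring

end DelSol

/-- If `f` and `g` solve `z'' = Q z`, their Wronskian is constant. -/
lemma wronskian_eq {Q f f' g g' : ℝ → ℝ} (hf : ∀ t, HasDerivAt f (f' t) t)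
    (hf' : ∀ t, HasDerivAt f' (Q t * f t) t) (hg : ∀ t, HasDerivAt g (g' t) t)
    (hg' : ∀ t, HasDerivAt g' (Q t * g t) t) (t : ℝ) :
    f t * g' t - f' t * g t = f 0 * g' 0 - f' 0 * g 0 := by
  have h : ∀ t, HasDerivAt (fun s => f s * g' s - f' s * g s) 0 t := fun t =>
    (((hf t).mul (hg' t)).sub ((hf' t).mul (hg t))).congr_deriv (by ring)
  exact is_const_of_deriv_eq_zero (fun t => (h t).differentiableAt) (fun t => (h t).deriv) t 0

/-- the conjugate Jacobi fields Φ± span the solutions of the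
first-spherical-harmonic projection z″ = ((n−1)a + p)z of the conjugate linearized
operator. -/
theorem first_harmonic_solutions (n k : ℕ) (hk : 2 ≤ 2 * k) (hkn : 2 * k < n)
    (H₀ : ℝ) (hH₀ : 0 < H₀) (hH₁ : H₀ < Hmax n k)
    (v : ℝ → ℝ) (hsol : DelSol n k H₀ v) :
    let Φp : ℝ → ℝ := fun t =>
      (hDel n k v t) ^ (((k : ℝ) - 1) / 2) * (alp n k * v t + deriv v t) * Real.exp t
    let Φm : ℝ → ℝ := fun t =>
      (hDel n k v t) ^ (((k : ℝ) - 1) / 2) * (alp n k * v t - deriv v t) * Real.exp (-t)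
    (∀ t : ℝ, deriv (deriv Φp) t =
      (((n : ℝ) - 1) * aDel n k H₀ v t + pDel n k H₀ v t) * Φp t) ∧
    (∀ t : ℝ, deriv (deriv Φm) t =
      (((n : ℝ) - 1) * aDel n k H₀ v t + pDel n k H₀ v t) * Φm t) ∧
    LinearIndependent ℝ ![Φp, Φm] ∧
    (∀ z : ℝ → ℝ, ContDiff ℝ 2 z →
      (∀ t : ℝ, deriv (deriv z) t =
        (((n : ℝ) - 1) * aDel n k H₀ v t + pDel n k H₀ v t) * z t) →
      ∃ A B : ℝ, z = fun t => A * Φp t + B * Φm t) := by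
  intro Φp Φm
  have hk1 : 1 ≤ k := by omega
  have hΦp : Φp = jacobiConj n k v 1 := by ext t; simp [Φp, jacobiConj]
  have hΦm : Φm = jacobiConj n k v (-1) := by ext t; simp [Φm, jacobiConj, sub_eq_add_neg]
  have hp := hsol.hasDerivAt_jacobiConj hk1 hkn hH₀ 1
  have hm := hsol.hasDerivAt_jacobiConj hk1 hkn hH₀ (-1)
  have hp' := hsol.hasDerivAt_jacobiConjDeriv hk1 hkn hH₀ (Or.inl rfl)
  have hm' := hsol.hasDerivAt_jacobiConjDeriv hk1 hkn hH₀ (Or.inr rfl)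
  rw [hΦp, hΦm]
  clear_value Φp Φm
  have hW : jacobiConj n k v 1 0 * jacobiConjDeriv n k H₀ v (-1) 0 -
      jacobiConjDeriv n k H₀ v 1 0 * jacobiConj n k v (-1) 0 < 0 := by
    have hα := alp_pos hk1 hkn
    have hx := hsol.pos 0
    have hE := rpow_pos_of_pos (hsol.hDel_pos hk1 hH₀ 0) (((k : ℝ) - 1) / 2)
    have hw : 0 < alp n k ^ 2 * (1 - (n : ℝ) / (n - 2 * k) * FDel n k H₀ v 0) := by
      have h1 := (hsol.hasDerivAt_deriv 0).div (hsol.hasDerivAt 0) hx.ne'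
      have h2 := h1.unique (hsol.hasDerivAt_logDeriv hk1 hkn hH₀ 0)
      simp only [hsol.2.2.2.1, zero_div, mul_zero, sub_zero, ne_eq, OfNat.ofNat_ne_zero,
        not_false_eq_true, zero_pow] at h2
      rw [← h2]
      have := hsol.2.2.2.2.1
      positivity
    simp only [jacobiConj, jacobiConjDeriv, hsol.2.2.2.1, mul_zero, zero_div, exp_zero]
    generalize hDel n k v 0 ^ (((k : ℝ) - 1) / 2) = P at *
    have h3 : 0 < P ^ 2 * v 0 ^ 2 * alp n k *
        (alp n k + alp n k ^ 2 * (1 - (n : ℝ) / (n - 2 * k) * FDel n k H₀ v 0)) := by positivity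
    nlinarith [h3]
  refine ⟨fun t => ?_, fun t => ?_, ?_, fun z hz hode => ?_⟩
  · rw [funext fun s => (hp s).deriv, (hp' t).deriv]
  · rw [funext fun s => (hm s).deriv, (hm' t).deriv]
  · rw [LinearIndependent.pair_iff]
    intro a b hab
    have hab0 : ∀ t, a * jacobiConj n k v 1 t + b * jacobiConj n k v (-1) t = 0 :=
      fun t => by simpa using congrFun hab t
    have hab1 : a * jacobiConjDeriv n k H₀ v 1 0 + b * jacobiConjDeriv n k H₀ v (-1) 0 = 0 := by
      have h := ((hp 0).const_mul a).add ((hm 0).const_mul b)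
      refine h.unique ((hasDerivAt_const (0 : ℝ) (0 : ℝ)).congr_of_eventuallyEq ?_)
      exact Filter.Eventually.of_forall hab0
    constructor
    · refine (mul_eq_zero.1 ?_).resolve_right hW.ne
      linear_combination jacobiConjDeriv n k H₀ v (-1) 0 * hab0 0 -
        jacobiConj n k v (-1) 0 * hab1
    · refine (mul_eq_zero.1 ?_).resolve_right hW.ne
      linear_combination jacobiConj n k v 1 0 * hab1 - jacobiConjDeriv n k H₀ v 1 0 * hab0 0
  · have hz1 : ∀ t, HasDerivAt z (deriv z t) t := fun t =>
      (hz.differentiable (by simp) t).hasDerivAt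
    have hz2 : ∀ t, HasDerivAt (deriv z)
        ((((n : ℝ) - 1) * aDel n k H₀ v t + pDel n k H₀ v t) * z t) t := fun t => by
      have h : ContDiff ℝ 1 (deriv z) := ((contDiff_succ_iff_deriv (n := 1)).1 hz).2.2
      rw [← hode t]
      exact (h.differentiable (by simp) t).hasDerivAt
    have hWt := wronskian_eq hp hp' hm hm'
    have hzp := wronskian_eq hz1 hz2 hp hp'
    have hzm := wronskian_eq hz1 hz2 hm hm'
    generalize jacobiConj n k v 1 0 * jacobiConjDeriv n k H₀ v (-1) 0 -
      jacobiConjDeriv n k H₀ v 1 0 * jacobiConj n k v (-1) 0 = W at *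
    generalize z 0 * jacobiConjDeriv n k H₀ v 1 0 - deriv z 0 * jacobiConj n k v 1 0 = Wp at *
    generalize z 0 * jacobiConjDeriv n k H₀ v (-1) 0 -
      deriv z 0 * jacobiConj n k v (-1) 0 = Wm at *
    refine ⟨Wm / W, -Wp / W, funext fun t => ?_⟩
    have hW0 := hW.ne
    field_simp
    linear_combination jacobiConj n k v 1 t * hzm t - jacobiConj n k v (-1) t * hzp t - z t * hWt t
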